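/- arXiv:0907.2286 — 2 statements merged into one kernel-verified Lean document; each statement's English description precedes it below -/
import Mathlib

section
/- For every integer g ≥ 3, one has (g-2) · ∑_{j=0}^{g-3} (-1)^j (j+1) · g!/((j+2)!·(g-3-j)!) − g · ∑_{j=0}^{g-3} (-1)^j (j+1) · C(g, j+3) = 0. -/
theorem aux_U (n : ℕ) (hn : n ≠ 0) :
    ∑ j ∈ Finset.range (n + 1), (-1 : ℤ) ^ j * (j + 1) * (Nat.choose (n + 1) (j + 1) : ℤ) = 0 := by
  have h := Int.alternating_sum_range_choose_of_ne hn
  have : ∀ j ∈ Finset.range (n + 1), (-1 : ℤ) ^ j * (j + 1) * (Nat.choose (n + 1) (j + 1) : ℤ)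
      = (n + 1) * ((-1 : ℤ) ^ j * (Nat.choose n j : ℤ)) := by
    intro j _
    have h2 : ((n : ℤ) + 1) * (Nat.choose n j : ℤ) = (Nat.choose (n + 1) (j + 1) : ℤ) * (j + 1) := by
      exact_mod_cast Nat.add_one_mul_choose_eq n j
    linear_combination (-(-1 : ℤ) ^ j) * h2
  rw [Finset.sum_congr rfl this, ← Finset.mul_sum, h, mul_zero]

theorem aux_T (n : ℕ) :
    ∑ j ∈ Finset.range (n + 1), (-1 : ℤ) ^ j * (j + 1) * (Nat.choose (n + 2) (j + 2) : ℤ) = 1 := by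
  induction n with
  | zero => simp
  | succ n ih =>
    have hU := aux_U (n + 1) (by omega)
    have : ∀ j ∈ Finset.range (n + 1 + 1),
        (-1 : ℤ) ^ j * (j + 1) * (Nat.choose (n + 1 + 2) (j + 2) : ℤ)
        = (-1 : ℤ) ^ j * (j + 1) * (Nat.choose (n + 1 + 1) (j + 1) : ℤ)
          + (-1 : ℤ) ^ j * (j + 1) * (Nat.choose (n + 2) (j + 2) : ℤ) := by
      intro j _
      rw [Nat.choose_succ_succ' (n + 2) (j + 1)]
      push_cast
      ring
    rw [Finset.sum_congr rfl this, Finset.sum_add_distrib, hU, Finset.sum_range_succ, ih,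
      Nat.choose_eq_zero_of_lt (by omega : n + 2 < n + 1 + 2)]
    simp

theorem aux_S (n : ℕ) :
    ∑ j ∈ Finset.range n, (-1 : ℤ) ^ j * (j + 1) * (Nat.choose (n + 2) (j + 3) : ℤ) = n := by
  induction n with
  | zero => simp
  | succ n ih =>
    have hT := aux_T n
    have : ∀ j ∈ Finset.range (n + 1),
        (-1 : ℤ) ^ j * (j + 1) * (Nat.choose (n + 1 + 2) (j + 3) : ℤ)
        = (-1 : ℤ) ^ j * (j + 1) * (Nat.choose (n + 2) (j + 2) : ℤ)
          + (-1 : ℤ) ^ j * (j + 1) * (Nat.choose (n + 2) (j + 3) : ℤ) := by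
      intro j _
      rw [Nat.choose_succ_succ' (n + 2) (j + 2)]
      push_cast
      ring
    rw [Finset.sum_congr rfl this, Finset.sum_add_distrib, hT, Finset.sum_range_succ, ih,
      Nat.choose_eq_zero_of_lt (by omega : n + 2 < n + 3)]
    push_cast
    ring


/-- For every integer `g ≥ 3`,
`(g-2) · ∑_{j=0}^{g-3} (-1)^j (j+1) · g!/((j+2)!·(g-3-j)!)`
`− g · ∑_{j=0}^{g-3} (-1)^j (j+1) · C(g, j+3) = 0`. -/
theorem key_vanishing (g : ℕ) (hg : 3 ≤ g) :
    ((g : ℤ) - 2) *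
        (∑ j ∈ Finset.range (g - 2),
          (-1 : ℤ) ^ j * (j + 1) *
            ((Nat.factorial g / (Nat.factorial (j + 2) * Nat.factorial (g - 3 - j)) : ℕ) : ℤ))
      - (g : ℤ) *
        (∑ j ∈ Finset.range (g - 2),
          (-1 : ℤ) ^ j * (j + 1) * (Nat.choose g (j + 3) : ℤ)) = 0 := by
  obtain ⟨n, rfl⟩ : ∃ n, g = n + 3 := ⟨g - 3, by omega⟩
  have e : n + 3 - 2 = n + 1 := by omega
  rw [e]
  have key : ∀ j ∈ Finset.range (n + 1),
      (-1 : ℤ) ^ j * (j + 1) *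
        ((Nat.factorial (n + 3) / (Nat.factorial (j + 2) * Nat.factorial (n + 3 - 3 - j)) : ℕ) : ℤ)
      = (n + 3) * ((-1 : ℤ) ^ j * (j + 1) * (Nat.choose (n + 2) (j + 2) : ℤ)) := by
    intro j hj
    have hj' : j ≤ n := by
      have := Finset.mem_range.mp hj
      omega
    have h1 : Nat.factorial (n + 3) / (Nat.factorial (j + 2) * Nat.factorial (n + 3 - 3 - j))
        = (n + 3) * Nat.choose (n + 2) (j + 2) := by
      apply Nat.div_eq_of_eq_mul_left (by positivity)
      have h := Nat.choose_mul_factorial_mul_factorial (by omega : j + 2 ≤ n + 2)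
      rw [show n + 2 - (j + 2) = n + 3 - 3 - j by omega] at h
      rw [Nat.factorial_succ (n + 2), ← h]
      ring
    rw [h1]
    push_cast
    ring
  have hS := aux_S (n + 1)
  rw [Finset.sum_congr rfl key, ← Finset.mul_sum, aux_T, hS]
  push_cast
  ring
end

section
/- For all integers d and g with 2 ≤ d ≤ g, one has ∑_{j=0}^{d-1} (-1)^j · C(g-d+j, j) · (g-d+j+1) · C(g, d-1-j) = 0. -/
/-- For all integers `d`, `g` with `2 ≤ d ≤ g`,
`∑_{j=0}^{d-1} (-1)^j · C(g-d+j, j) · (g-d+j+1) · C(g, d-1-j) = 0`. -/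
theorem theta_gamma_pencil_zero (d g : ℕ) (hd : 2 ≤ d) (hdg : d ≤ g) :
    ∑ j ∈ Finset.range d,
      (-1 : ℤ) ^ j * (Nat.choose (g - d + j) j : ℤ) * ((g : ℤ) - d + j + 1) *
        (Nat.choose g (d - 1 - j) : ℤ) = 0 := by
  obtain ⟨m, rfl⟩ := Nat.exists_eq_add_of_le hdg
  obtain ⟨n, rfl⟩ : ∃ n, d = n + 1 := ⟨d - 1, by omega⟩
  have hn : n ≠ 0 := by omega
  have key : ∀ j ∈ Finset.range (n + 1),
      (-1 : ℤ) ^ j * (Nat.choose (n + 1 + m - (n + 1) + j) j : ℤ) *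
        (((n + 1 + m : ℕ) : ℤ) - (n + 1 : ℕ) + j + 1) *
        (Nat.choose (n + 1 + m) (n + 1 - 1 - j) : ℤ)
      = ((m + 1) * Nat.choose (n + 1 + m) (m + 1) : ℤ) * ((-1 : ℤ) ^ j * (Nat.choose n j : ℤ)) := by
    intro j hj
    have hj' : j ≤ n := by simpa [Nat.lt_succ_iff] using hj
    have e1 : n + 1 + m - (n + 1) + j = m + j := by omega
    have e2 : n + 1 - 1 - j = n - j := by omega
    have h1 : Nat.choose (m + j) j = Nat.choose (m + j) m := by
      rw [Nat.choose_symm_add]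
    have h2 : Nat.choose (n + 1 + m) (n - j) = Nat.choose (n + 1 + m) (m + j + 1) :=
      Nat.choose_symm_of_eq_add (by omega)
    have h3 := Nat.add_one_mul_choose_eq (m + j) m
    have h4 := Nat.choose_mul (n := n + 1 + m) (k := m + j + 1) (s := m + 1) (by omega)
    rw [show n + 1 + m - (m + 1) = n by omega, show m + j + 1 - (m + 1) = j by omega] at h4
    rw [e1, e2, h1, h2]
    zify at h3 h4
    push_cast
    linear_combination (-1 : ℤ) ^ j * (Nat.choose (n + 1 + m) (m + j + 1) : ℤ) * h3
      + (-1 : ℤ) ^ j * (m + 1) * h4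
  rw [Finset.sum_congr rfl key, ← Finset.mul_sum, Int.alternating_sum_range_choose_of_ne hn, mul_zero]
end
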